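/- Low-Mach-number limit for the two-phase one-velocity system with PDE pressure closure (order-by-order form of Proposition 3.2). Let d ≥ 1, γ₊, γ₋ > 1, μ, λ ∈ ℝ and μ̄ > 0. Let α₊⁰, α₋⁰, α₊¹, α₋¹, ρ₊⁰, ρ₋⁰, ρ₊¹, ρ₋¹ : ℝ × ℝ^d → ℝ and u⁰ : ℝ × ℝ^d → ℝ^d be smooth ℤ^d-periodic functions with ρ₊⁰ > 0, ρ₋⁰ > 0, 0 < α₊⁰ < 1 everywhere, satisfying: (i) α₊⁰ + α₋⁰ = 1 and α₊¹ + α₋¹ = 0; (ii) α₊⁰α₋⁰((ρ₊⁰)^{γ₊} − (ρ₋⁰)^{γ₋}) = 0; (iii) ∇(α₊⁰(ρ₊⁰)^{γ₊} + α₋⁰(ρ₋⁰)^{γ₋}) = 0; (iv) ∂ₜ(α₊⁰ρ₊⁰) + div(α₊⁰ρ₊⁰u⁰) = 0 and ∂ₜ(α₋⁰ρ₋⁰) + div(α₋⁰ρ₋⁰u⁰) = 0; (v) ∂ₜα₊⁰ + u⁰·∇α₊⁰ = (1/μ̄)·α₊⁰α₋⁰·(γ₊(ρ₊⁰)^{γ₊−1}ρ₊¹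 − γ₋(ρ₋⁰)^{γ₋−1}ρ₋¹); (vi) ∂ₜ((α₊⁰ρ₊⁰+α₋⁰ρ₋⁰)u⁰) + div((α₊⁰ρ₊⁰+α₋⁰ρ₋⁰)u⁰⊗u⁰) + ∇(α₊⁰γ₊(ρ₊⁰)^{γ₊−1}ρ₊¹ + α₋⁰γ₋(ρ₋⁰)^{γ₋−1}ρ₋¹ + α₊¹(ρ₊⁰)^{γ₊} + α₋¹(ρ₋⁰)^{γ₋}) = μΔu⁰ + (μ+λ)∇(div u⁰). Then: (ρ₊⁰)^{γ₊} = (ρ₋⁰)^{γ₋}; ρ₊⁰ and ρ₋⁰ are constant in space and time; div u⁰ = 0; ∂ₜα₊⁰ + u⁰·∇α₊⁰ = 0; γ₊(ρ₊⁰)^{γ₊−1}ρ₊¹ = γ₋(ρ₋⁰)^{γ₋−1}ρ₋¹; and, setting π := γ₊(ρ₊⁰)^{γ₊−1}ρ₊¹, the limit momentum equation ∂ₜ((α₊⁰ρ₊⁰+α₋⁰ρ₋⁰)u⁰) + div((α₊⁰ρ₊⁰+α₋⁰ρ₋⁰)u⁰⊗u⁰) + ∇π = μΔu⁰ holds. 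-/

import Mathlib

open MeasureTheory Real

noncomputable section

/-- A space–time point: time in `ℝ`, space in `ℝ^d`. -/
abbrev Pt (d : ℕ) := ℝ × (Fin d → ℝ)

/-- Time derivative `∂ₜ f`. -/
def pt {d : ℕ} (f : Pt d → ℝ) (p : Pt d) : ℝ :=
  fderiv ℝ f p (1, 0)

/-- Spatial partial derivative `∂_{x i} f`. -/
def pd {d : ℕ} (i : Fin d) (f : Pt d → ℝ) (p : Pt d) : ℝ :=
  fderiv ℝ f p (0, Pi.single i 1)

/-- Spatial divergence of a vector field. -/
def divg {d : ℕ} (u : Pt d → Fin d → ℝ) (p : Pt d) : ℝ :=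
  ∑ i, pd i (fun q => u q i) p

/-- Spatial Laplacian of a scalar function. -/
def lap {d : ℕ} (f : Pt d → ℝ) (p : Pt d) : ℝ :=
  ∑ i, pd i (fun q => pd i f q) p

/-- `i`-th component of `div (r u ⊗ u)`, i.e. `∑ j ∂_{x j} (r u_i u_j)`. -/
def divT {d : ℕ} (r : Pt d → ℝ) (u : Pt d → Fin d → ℝ) (p : Pt d) (i : Fin d) : ℝ :=
  ∑ j, pd j (fun q => r q * u q i * u q j) p

/-- Symmetric gradient `D(u) = (∇u + (∇u)ᵀ)/2`. -/
def Dsym {d : ℕ} (u : Pt d → Fin d → ℝ) (p : Pt d) (i j : Fin d) : ℝ :=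
  (pd j (fun q => u q i) p + pd i (fun q => u q j) p) / 2

/-- Divergence of a matrix field, `i`-th component `∑ j ∂_{x j} M_{ij}`. -/
def divM {d : ℕ} (M : Pt d → Fin d → Fin d → ℝ) (p : Pt d) (i : Fin d) : ℝ :=
  ∑ j, pd j (fun q => M q i j) p

/-- `ℤ^d`-periodicity in the space variable. -/
def ZPeriodic {d : ℕ} (f : Pt d → ℝ) : Prop :=
  ∀ (k : Fin d → ℤ) (t : ℝ) (x : Fin d → ℝ), f (t, x + fun i => (k i : ℝ)) = f (t, x)

/-- `ℤ^d`-periodicity of a vector field. -/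
def ZPeriodicVec {d : ℕ} (u : Pt d → Fin d → ℝ) : Prop :=
  ∀ i, ZPeriodic (fun q => u q i)

/-- The unit cell `[0,1]^d`. -/
def cell (d : ℕ) : Set (Fin d → ℝ) := Set.Icc 0 1

section Calculus

variable {d : ℕ}

theorem fderiv_eq_pt_add_sum_pd (f : Pt d → ℝ) (p v : Pt d) :
    fderiv ℝ f p v = v.1 * pt f p + ∑ i, v.2 i * pd i f p := by
  have hv : v = v.1 • ((1, 0) : Pt d) + ∑ i, v.2 i • ((0, Pi.single i 1) : Pt d) := by
    refine Prod.ext ?_ ?_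
    · simp [Prod.fst_sum]
    · funext j
      simp [Prod.snd_sum, Finset.sum_apply, Pi.single_apply]
  conv_lhs => rw [hv]
  simp only [map_add, map_sum, map_smul, smul_eq_mul, pt, pd]

theorem pt_mul {f g : Pt d → ℝ} (hf : Differentiable ℝ f) (hg : Differentiable ℝ g) (p : Pt d) :
    pt (fun q => f q * g q) p = f p * pt g p + g p * pt f p := by
  simp [pt, fderiv_fun_mul (hf p) (hg p)]

theorem pd_mul {f g : Pt d → ℝ} (hf : Differentiable ℝ f) (hg : Differentiable ℝ g) (i : Fin d)
    (p : Pt d) : pd i (fun q => f q * g q) p = f p * pd i g p + g p * pd i f p := by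
  simp [pd, fderiv_fun_mul (hf p) (hg p)]

theorem pt_rpow {f : Pt d → ℝ} (hf : Differentiable ℝ f) (hpos : ∀ p, 0 < f p) (γ : ℝ) (p : Pt d) :
    pt (fun q => f q ^ γ) p = γ * f p ^ (γ - 1) * pt f p := by
  simp [pt, ((hf p).hasFDerivAt.rpow_const (p := γ) (.inl (hpos p).ne')).fderiv]

theorem pd_rpow {f : Pt d → ℝ} (hf : Differentiable ℝ f) (hpos : ∀ p, 0 < f p) (γ : ℝ) (i : Fin d)
    (p : Pt d) : pd i (fun q => f q ^ γ) p = γ * f p ^ (γ - 1) * pd i f p := by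
  simp [pd, ((hf p).hasFDerivAt.rpow_const (p := γ) (.inl (hpos p).ne')).fderiv]

/-- A function whose spatial partial derivatives vanish depends on time only. -/
theorem eq_of_pd_eq_zero {f : Pt d → ℝ} (hf : Differentiable ℝ f) (h : ∀ p i, pd i f p = 0)
    (t : ℝ) (x y : Fin d → ℝ) : f (t, x) = f (t, y) := by
  have hd : ∀ z, HasFDerivAt (fun z => f (t, z))
      ((fderiv ℝ f (t, z)).comp (ContinuousLinearMap.inr ℝ ℝ (Fin d → ℝ))) z := fun z =>
    (hf (t, z)).hasFDerivAt.comp z (hasFDerivAt_prodMk_right t z)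
  refine is_const_of_fderiv_eq_zero (𝕜 := ℝ) (fun z => (hd z).differentiableAt) (fun z => ?_) x y
  rw [(hd z).fderiv]
  ext v
  simp [fderiv_eq_pt_add_sum_pd, h]

theorem pt_eq_of_pd_eq_zero {f : Pt d → ℝ} (hf : Differentiable ℝ f) (h : ∀ p i, pd i f p = 0)
    (t : ℝ) (x y : Fin d → ℝ) : pt f (t, x) = pt f (t, y) := by
  have htr : (fun q : Pt d => f (q + (0, y - x))) = f := by
    funext q
    rw [show q + (0, y - x) = (q.1, q.2 + (y - x)) by ext <;> simp]
    exact eq_of_pd_eq_zero hf h q.1 _ _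
  have := fderiv_comp_add_right (𝕜 := ℝ) (f := f) (x := ((t, x) : Pt d)) ((0, y - x) : Pt d)
  rw [htr] at this
  simp [pt, this]

theorem eq_of_pt_pd_eq_zero {f : Pt d → ℝ} (hf : Differentiable ℝ f) (ht : ∀ p, pt f p = 0)
    (h : ∀ p i, pd i f p = 0) (p q : Pt d) : f p = f q := by
  refine is_const_of_fderiv_eq_zero (𝕜 := ℝ) hf (fun z => ?_) p q
  refine ContinuousLinearMap.ext fun v => ?_
  simp [fderiv_eq_pt_add_sum_pd, h, ht]

/-- Product-rule expansion of the mass balance of a phase with volume fraction `α`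
and density `ρ`. -/
theorem mass_balance_expand {α ρ : Pt d → ℝ} {u : Pt d → Fin d → ℝ} (hα : Differentiable ℝ α)
    (hρ : Differentiable ℝ ρ) (hu : Differentiable ℝ u) (h : ∀ p i, pd i ρ p = 0) (p : Pt d) :
    pt (fun q => α q * ρ q) p + divg (fun q j => α q * ρ q * u q j) p
      = ρ p * (pt α p + ∑ i, u p i * pd i α p) + α p * pt ρ p + α p * ρ p * divg u p := by
  have hi : ∀ i, pd i (fun q => α q * ρ q * u q i) p
      = α p * ρ p * pd i (fun q => u q i) p + ρ p * (u p i * pd i α p) := fun i => by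
    rw [pd_mul (f := fun q => α q * ρ q) (hα.mul hρ) (differentiable_pi.1 hu i), pd_mul hα hρ, h]
    ring
  rw [pt_mul hα hρ]
  simp only [divg, hi, Finset.sum_add_distrib, ← Finset.mul_sum]
  ring

theorem continuous_pd {f : Pt d → ℝ} (hf : ContDiff ℝ 1 f) (i : Fin d) : Continuous (pd i f) :=
  (hf.continuous_fderiv one_ne_zero).clm_apply continuous_const

theorem continuous_divg {u : Pt d → Fin d → ℝ} (hu : ContDiff ℝ 1 u) : Continuous (divg u) :=
  continuous_finsetSum _ fun i _ => continuous_pd (contDiff_pi.1 hu i) i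

theorem isCompact_cell : IsCompact (cell d) := isCompact_Icc

theorem setIntegral_cell_pos {g : (Fin d → ℝ) → ℝ} (hg : Continuous g) (hpos : ∀ x, 0 < g x) :
    0 < ∫ x in cell d, g x := by
  rw [setIntegral_pos_iff_support_of_nonneg_ae (.of_forall fun x => (hpos x).le)
    (hg.continuousOn.integrableOn_compact isCompact_cell)]
  rw [(Set.eq_univ_of_forall fun x => (hpos x).ne' : Function.support g = Set.univ),
    Set.univ_inter, cell, Real.volume_Icc_pi]
  simp

/-- The divergence of a periodic vector field has zero mean over the unit cell. -/
theorem setIntegral_cell_divg_eq_zero {u : Pt d → Fin d → ℝ} (hu : ContDiff ℝ 1 u)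
    (hper : ZPeriodicVec u) (t : ℝ) : ∫ x in cell d, divg u (t, x) = 0 := by
  cases d with
  | zero => simp [divg]
  | succ n =>
    have hui : ∀ i, ContDiff ℝ 1 (fun q => u q i) := contDiff_pi.1 hu
    have key := integral_divergence_of_hasFDerivAt_off_countable' (0 : Fin (n + 1) → ℝ) 1
      (by intro i; simp) (fun i x => u (t, x) i)
      (fun i x => (fderiv ℝ (fun q => u q i) (t, x)).comp
        (ContinuousLinearMap.inr ℝ ℝ (Fin (n + 1) → ℝ)))
      ∅ Set.countable_empty
      (fun i => ((hui i).continuous.comp (by fun_prop :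
        Continuous fun x : Fin (n + 1) → ℝ => (t, x))).continuousOn)
      (fun x _ i => (((hui i).differentiable one_ne_zero) (t, x)).hasFDerivAt.comp x
        (hasFDerivAt_prodMk_right t x))
      (((continuous_divg hu).comp (by fun_prop :
        Continuous fun x : Fin (n + 1) → ℝ => (t, x))).continuousOn.integrableOn_compact
          isCompact_Icc)
    refine (Eq.trans ?_ key).trans ?_
    · rfl
    · refine Finset.sum_eq_zero fun i _ => sub_eq_zero.2 ?_
      congr 1
      funext x
      refine Eq.trans ?_ (hper i (Pi.single i 1) t (i.insertNth 0 x))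
      refine congrArg (fun z => u (t, z) i) (funext fun j => ?_)
      refine Fin.succAboveCases i ?_ (fun k => ?_) j <;> simp

end Calculus

/-- low-Mach-number limit for the two-phase one-velocity system with
PDE pressure closure (order-by-order form of Proposition 3.2). -/
theorem lowMach_twoPhase_oneVelocity_PDEclosure
    {d : ℕ} (hd : 1 ≤ d) (γp γm μ lam μbar : ℝ) (hγp : 1 < γp) (hγm : 1 < γm)
    (hμbar : 0 < μbar)
    (αp0 αm0 αp1 αm1 ρp0 ρm0 ρp1 ρm1 : Pt d → ℝ) (u0 : Pt d → Fin d → ℝ)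
    (hreg : ContDiff ℝ (⊤ : ℕ∞) αp0 ∧ ContDiff ℝ (⊤ : ℕ∞) αm0 ∧ ContDiff ℝ (⊤ : ℕ∞) αp1 ∧ ContDiff ℝ (⊤ : ℕ∞) αm1 ∧
      ContDiff ℝ (⊤ : ℕ∞) ρp0 ∧ ContDiff ℝ (⊤ : ℕ∞) ρm0 ∧ ContDiff ℝ (⊤ : ℕ∞) ρp1 ∧ ContDiff ℝ (⊤ : ℕ∞) ρm1 ∧
      ContDiff ℝ (⊤ : ℕ∞) u0)
    (hper : ZPeriodic αp0 ∧ ZPeriodic αm0 ∧ ZPeriodic αp1 ∧ ZPeriodic αm1 ∧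
      ZPeriodic ρp0 ∧ ZPeriodic ρm0 ∧ ZPeriodic ρp1 ∧ ZPeriodic ρm1 ∧ ZPeriodicVec u0)
    (hρp : ∀ p, 0 < ρp0 p) (hρm : ∀ p, 0 < ρm0 p)
    (hαpos : ∀ p, 0 < αp0 p ∧ αp0 p < 1)
    -- (i)
    (hα0 : ∀ p, αp0 p + αm0 p = 1) (hα1 : ∀ p, αp1 p + αm1 p = 0)
    -- (ii)
    (hpeq0 : ∀ p, αp0 p * αm0 p * (ρp0 p ^ γp - ρm0 p ^ γm) = 0)
    -- (iii)
    (hgrad : ∀ p (i : Fin d),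
      pd i (fun q => αp0 q * ρp0 q ^ γp + αm0 q * ρm0 q ^ γm) p = 0)
    -- (iv)
    (hmassp : ∀ p, pt (fun q => αp0 q * ρp0 q) p
      + divg (fun q j => αp0 q * ρp0 q * u0 q j) p = 0)
    (hmassm : ∀ p, pt (fun q => αm0 q * ρm0 q) p
      + divg (fun q j => αm0 q * ρm0 q * u0 q j) p = 0)
    -- (v)
    (hclosure : ∀ p : Pt d, pt αp0 p + ∑ i, u0 p i * pd i αp0 p
      = (1 / μbar) * (αp0 p * αm0 p)
        * (γp * ρp0 p ^ (γp - 1) * ρp1 p - γm * ρm0 p ^ (γm - 1) * ρm1 p))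
    -- (vi)
    (hmom : ∀ p (i : Fin d),
      pt (fun q => (αp0 q * ρp0 q + αm0 q * ρm0 q) * u0 q i) p
      + divT (fun q => αp0 q * ρp0 q + αm0 q * ρm0 q) u0 p i
      + pd i (fun q => αp0 q * (γp * ρp0 q ^ (γp - 1) * ρp1 q)
          + αm0 q * (γm * ρm0 q ^ (γm - 1) * ρm1 q)
          + αp1 q * ρp0 q ^ γp + αm1 q * ρm0 q ^ γm) p
      = μ * lap (fun q => u0 q i) p + (μ + lam) * pd i (divg u0) p) :
    -- conclusions
    (∀ p : Pt d, ρp0 p ^ γp = ρm0 p ^ γm) ∧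
    (∀ p q : Pt d, ρp0 p = ρp0 q) ∧ (∀ p q : Pt d, ρm0 p = ρm0 q) ∧
    (∀ p : Pt d, divg u0 p = 0) ∧
    (∀ p : Pt d, pt αp0 p + ∑ i, u0 p i * pd i αp0 p = 0) ∧
    (∀ p : Pt d, γp * ρp0 p ^ (γp - 1) * ρp1 p = γm * ρm0 p ^ (γm - 1) * ρm1 p) ∧
    (∀ p (i : Fin d),
      pt (fun q => (αp0 q * ρp0 q + αm0 q * ρm0 q) * u0 q i) p
      + divT (fun q => αp0 q * ρp0 q + αm0 q * ρm0 q) u0 p i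
      + pd i (fun q => γp * ρp0 q ^ (γp - 1) * ρp1 q) p
      = μ * lap (fun q => u0 q i) p) := by
  obtain ⟨sαp, sαm, -, -, sρp, sρm, -, -, su⟩ := hreg
  have dαp := sαp.differentiable (by simp)
  have dαm := sαm.differentiable (by simp)
  have dρp := sρp.differentiable (by simp)
  have dρm := sρm.differentiable (by simp)
  have du := su.differentiable (by simp)
  have hu1 : ContDiff ℝ 1 u0 := su.of_le (by exact_mod_cast le_top)
  have hγp0 : 0 < γp := by linarith
  have hγm0 : 0 < γm := by linarith
  have hαm : ∀ p, 0 < αm0 p := fun p => by linarith [hα0 p, (hαpos p).2]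
  have hP : ∀ p, ρp0 p ^ γp = ρm0 p ^ γm := fun p => by
    have := hpeq0 p
    rw [mul_eq_zero_iff_left (mul_pos (hαpos p).1 (hαm p)).ne'] at this
    linarith
  have hPfun : (fun q => ρp0 q ^ γp) = fun q => ρm0 q ^ γm := funext hP
  have hmix : (fun q => αp0 q * ρp0 q ^ γp + αm0 q * ρm0 q ^ γm) = fun q => ρp0 q ^ γp := by
    funext q
    rw [← hP q, ← add_mul, hα0, one_mul]
  have hcoef : ∀ {γ r : ℝ}, 0 < γ → 0 < r → γ * r ^ (γ - 1) ≠ 0 := fun hγ hr =>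
    (mul_pos hγ (rpow_pos_of_pos hr _)).ne'
  have hxp : ∀ p i, pd i ρp0 p = 0 := fun p i => by
    have := hgrad p i
    rw [hmix, pd_rpow dρp hρp] at this
    exact (mul_eq_zero.1 this).resolve_left (hcoef hγp0 (hρp p))
  have hxm : ∀ p i, pd i ρm0 p = 0 := fun p i => by
    have := hgrad p i
    rw [hmix, hPfun, pd_rpow dρm hρm] at this
    exact (mul_eq_zero.1 this).resolve_left (hcoef hγm0 (hρm p))
  have htime : ∀ p, γp * (pt ρp0 p / ρp0 p) = γm * (pt ρm0 p / ρm0 p) := fun p => by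
    have h : pt (fun q => ρp0 q ^ γp) p = pt (fun q => ρm0 q ^ γm) p := by rw [hPfun]
    rw [pt_rpow dρp hρp, pt_rpow dρm hρm, rpow_sub_one (hρp p).ne', rpow_sub_one (hρm p).ne',
      hP p] at h
    have hpos := rpow_pos_of_pos (hρm p) γm
    apply mul_left_cancel₀ hpos.ne'
    linear_combination h
  -- the transport derivatives of the two volume fractions are opposite
  have hαm_eq : αm0 = fun q => 1 - αp0 q := funext fun q => by linarith [hα0 q]
  have hopp : ∀ p, pt αm0 p + ∑ i, u0 p i * pd i αm0 p
      = -(pt αp0 p + ∑ i, u0 p i * pd i αp0 p) := fun p => by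
    rw [hαm_eq]
    simp [pt, pd, fderiv_const_sub, Finset.sum_neg_distrib]
    ring
  have hmp := fun p => (mass_balance_expand dαp dρp du hxp p).symm.trans (hmassp p)
  have hmm := fun p => (mass_balance_expand dαm dρm du hxm p).symm.trans (hmassm p)
  have hdiv : ∀ p, divg u0 p
      = -(pt ρp0 p / ρp0 p) * (αp0 p + αm0 p * (γp / γm)) := fun p => by
    have hp0 := (hρp p).ne'
    have hm0 := (hρm p).ne'
    have h1 : (pt αp0 p + ∑ i, u0 p i * pd i αp0 p) + αp0 p * (pt ρp0 p / ρp0 p)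
        + αp0 p * divg u0 p = 0 := by
      apply mul_left_cancel₀ hp0
      rw [mul_zero, ← hmp p]
      field_simp
    have h2 : -(pt αp0 p + ∑ i, u0 p i * pd i αp0 p) + αm0 p * (pt ρm0 p / ρm0 p)
        + αm0 p * divg u0 p = 0 := by
      rw [← hopp]
      apply mul_left_cancel₀ hm0
      rw [mul_zero, ← hmm p]
      field_simp
    have h3 : pt ρm0 p / ρm0 p = γp / γm * (pt ρp0 p / ρp0 p) := by
      rw [div_mul_eq_mul_div, htime p, mul_div_cancel_left₀ _ hγm0.ne']
    rw [h3] at h2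
    linear_combination h1 + h2 - divg u0 p * hα0 p
  have htp : ∀ p, pt ρp0 p = 0 := by
    rintro ⟨t, y⟩
    have hc : ∀ x, divg u0 (t, x)
        = -(pt ρp0 (t, y) / ρp0 (t, y)) * (αp0 (t, x) + αm0 (t, x) * (γp / γm)) := fun x => by
      rw [hdiv, pt_eq_of_pd_eq_zero dρp hxp t x y, eq_of_pd_eq_zero dρp hxp t x y]
    have hint := setIntegral_cell_divg_eq_zero hu1 hper.2.2.2.2.2.2.2.2 t
    have hpos : 0 < ∫ x in cell d, (αp0 (t, x) + αm0 (t, x) * (γp / γm)) := by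
      refine setIntegral_cell_pos ?_ fun x =>
        add_pos (hαpos _).1 (mul_pos (hαm _) (div_pos hγp0 hγm0))
      have := sαp.continuous
      have := sαm.continuous
      fun_prop
    simp only [hc, integral_const_mul] at hint
    have := (mul_eq_zero.1 hint).resolve_right hpos.ne'
    exact (div_eq_zero_iff.1 (neg_eq_zero.1 this)).resolve_right (hρp _).ne'
  have htm : ∀ p, pt ρm0 p = 0 := fun p => by
    have := htime p
    rw [htp p, zero_div, mul_zero] at this
    simpa [hγm0.ne', (hρm p).ne'] using this.symm
  have hdiv0 : ∀ p, divg u0 p = 0 := fun p => by rw [hdiv, htp]; simp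
  have htrans : ∀ p, pt αp0 p + ∑ i, u0 p i * pd i αp0 p = 0 := fun p => by
    have := hmp p
    rw [htp, hdiv0, mul_zero, mul_zero, add_zero, add_zero] at this
    exact (mul_eq_zero.1 this).resolve_left (hρp p).ne'
  have hpi : ∀ p, γp * ρp0 p ^ (γp - 1) * ρp1 p = γm * ρm0 p ^ (γm - 1) * ρm1 p := fun p => by
    have := hclosure p
    rw [htrans] at this
    exact sub_eq_zero.1 ((mul_eq_zero.1 this.symm).resolve_left
      (mul_pos (one_div_pos.2 hμbar) (mul_pos (hαpos p).1 (hαm p))).ne')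
  refine ⟨hP, eq_of_pt_pd_eq_zero dρp htp hxp, eq_of_pt_pd_eq_zero dρm htm hxm, hdiv0, htrans, hpi,
    fun p i => ?_⟩
  have hpress : (fun q => αp0 q * (γp * ρp0 q ^ (γp - 1) * ρp1 q)
      + αm0 q * (γm * ρm0 q ^ (γm - 1) * ρm1 q) + αp1 q * ρp0 q ^ γp + αm1 q * ρm0 q ^ γm)
      = fun q => γp * ρp0 q ^ (γp - 1) * ρp1 q := by
    funext q
    rw [← hpi q, ← hP q]
    linear_combination (γp * ρp0 q ^ (γp - 1) * ρp1 q) * hα0 q + ρp0 q ^ γp * hα1 q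
  have hzero : pd i (divg u0) p = 0 := by
    rw [(funext hdiv0 : divg u0 = fun _ => 0)]
    simp [pd]
  have := hmom p i
  rwa [hpress, hzero, mul_zero, add_zero] at this
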